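/- arXiv:1812.10849 — 6 statements merged into one kernel-verified Lean document; each statement's English description precedes it below -/
import Mathlib

section
/- If two finite simple graphs G and H are homeomorphic (i.e., G and H are both isomorphic to subdivisions of one common graph K), then G ∈ 𝒰 if and only if H ∈ 𝒰. -/
open SimpleGraph

namespace Sat2

abbrev Lit (V : Type) := V × Bool
abbrev TwoCNF (V : Type) := List (Lit V × Lit V)

/-- An assignment satisfies a 2-CNF if it satisfies at least one literal
of every clause. -/
def SatTwoCNF {V : Type} (τ : V → Bool) (S : TwoCNF V) : Prop :=
  ∀ c ∈ S, τ c.1.1 = c.1.2 ∨ τ c.2.1 = c.2.2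

def TwoSatisfiable {V : Type} (S : TwoCNF V) : Prop := ∃ τ, SatTwoCNF τ S

/-- The unordered pair of underlying variables of a 2-clause. -/
def clauseVars {V : Type} (c : Lit V × Lit V) : Sym2 V := s(c.1.1, c.2.1)

/-- A 2-CNF is simple if in every clause the two literals have distinct
underlying variables, and no two distinct clauses have the same unordered
pair of underlying variables. -/
def SimpleTwoCNF {V : Type} (S : TwoCNF V) : Prop :=
  (∀ c ∈ S, c.1.1 ≠ c.2.1) ∧ (S.map clauseVars).Nodup

/-- A 2-CNF `S` is supported on a simple graph `G` (with vertex type equal to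
the variable type) when clause ↦ unordered pair of variables is a bijection
from the clauses of `S` onto the edges of `G`. -/
def SupportedOn {V : Type} (S : TwoCNF V) (G : SimpleGraph V) : Prop :=
  (S.map clauseVars).Nodup ∧ {e : Sym2 V | e ∈ S.map clauseVars} = G.edgeSet

/-- `G ∈ 𝒰`: some unsatisfiable simple 2-CNF is supported on `G`. -/
def InU {V : Type} (G : SimpleGraph V) : Prop :=
  ∃ S : TwoCNF V, SimpleTwoCNF S ∧ SupportedOn S G ∧ ¬ TwoSatisfiable S

/-- `G` is isomorphic to a subgraph of `H`. -/
def IsSubgraphOf {α β : Type} (G : SimpleGraph α) (H : SimpleGraph β) : Prop :=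
  ∃ f : α → β, Function.Injective f ∧ ∀ ⦃u v⦄, G.Adj u v → H.Adj (f u) (f v)

/-- The graph obtained from `G` by subdividing the edge `(u, v)`:
the edge `(u,v)` is replaced by a path `u – w – v` through the
new vertex `w = none`. -/
def subdivideEdge {α : Type} (G : SimpleGraph α) (u v : α) :
    SimpleGraph (Option α) :=
  SimpleGraph.fromRel (fun a b =>
    match a, b with
    | some x, some y => G.Adj x y ∧ s(x, y) ≠ s(u, v)
    | some x, none => x = u ∨ x = v
    | _, _ => False)

/-- `IsSubdivision G H` : `H` is (up to starting isomorphism) obtained from `G`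
by repeatedly subdividing edges. -/
inductive IsSubdivision : {α β : Type} → SimpleGraph α → SimpleGraph β → Prop where
  | of_iso {α β : Type} {G : SimpleGraph α} {H : SimpleGraph β} :
      (G ≃g H) → IsSubdivision G H
  | step {α β : Type} {G : SimpleGraph α} {H : SimpleGraph β} (u v : β) :
      IsSubdivision G H → H.Adj u v → IsSubdivision G (subdivideEdge H u v)

/-- `G` is a topological minor of `H`: some subdivision of `G` is isomorphic
to a subgraph of `H`. -/
def IsTopMinor {α β : Type} (G : SimpleGraph α) (H : SimpleGraph β) : Prop :=
  ∃ (γ : Type) (G' : SimpleGraph γ), IsSubdivision G G' ∧ IsSubgraphOf G' H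

/-- Contraction of the edge `(u,v)`: delete `v` and merge it into `u`. -/
def contractEdge {α : Type} (G : SimpleGraph α) (u v : α) :
    SimpleGraph {w : α // w ≠ v} :=
  SimpleGraph.fromRel (fun a b =>
    G.Adj a.val b.val ∨ (a.val = u ∧ G.Adj v b.val) ∨ (b.val = u ∧ G.Adj a.val v))

/-- `ContractionSeq H G` : `G` can be obtained from `H` by a sequence of edge
contractions, each performed at an edge whose endpoints have no common
neighbor at the time of contraction. -/
inductive ContractionSeq : {α β : Type} → SimpleGraph α → SimpleGraph β → Prop where
  | of_iso {α β : Type} {H : SimpleGraph α} {G : SimpleGraph β} :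
      (H ≃g G) → ContractionSeq H G
  | step {α β : Type} {H : SimpleGraph α} {G : SimpleGraph β} (u v : α) :
      H.Adj u v → (∀ w, ¬(H.Adj u w ∧ H.Adj v w)) →
      ContractionSeq (contractEdge H u v) G → ContractionSeq H G

/-- The butterfly graph: two triangles sharing exactly one vertex. -/
def butterfly : SimpleGraph (Fin 5) :=
  SimpleGraph.fromEdgeSet {s(0,1), s(0,2), s(1,2), s(2,3), s(2,4), s(3,4)}

/-- The bowtie graph: two vertex-disjoint triangles joined by a single edge. -/
def bowtie : SimpleGraph (Fin 6) :=
  SimpleGraph.fromEdgeSet {s(0,1), s(0,2), s(1,2), s(2,3), s(3,4), s(3,5), s(4,5)}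

/-- The complete graph on four vertices. -/
def K4 : SimpleGraph (Fin 4) := ⊤

/-- The complete tripartite graph `K_{1,1,3}`, with parts {0}, {1}, {2,3,4}. -/
def K113 : SimpleGraph (Fin 5) :=
  SimpleGraph.fromEdgeSet {s(0,1), s(0,2), s(0,3), s(0,4), s(1,2), s(1,3), s(1,4)}

/-- The complete graph on four vertices with one edge deleted. -/
def K4minusE : SimpleGraph (Fin 4) :=
  SimpleGraph.fromEdgeSet {s(0,1), s(0,2), s(0,3), s(1,2), s(1,3)}

/-- `f x y` is the sign of the literal at `x` in the clause carried by the edge `xy`; the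
formula given by `f` on `G` is unsatisfiable if every assignment violates some clause. -/
def UnsatSigns {V : Type} (G : SimpleGraph V) (f : V → V → Bool) : Prop :=
  ∀ τ : V → Bool, ∃ x y, G.Adj x y ∧ τ x ≠ f x y ∧ τ y ≠ f y x

theorem InU.finite_edgeSet {V : Type} {G : SimpleGraph V} (h : InU G) : G.edgeSet.Finite := by
  obtain ⟨S, -, ⟨-, hS⟩, -⟩ := h
  rw [← hS]
  exact List.finite_toSet _

theorem InU.exists_unsatSigns {V : Type} {G : SimpleGraph V} (h : InU G) :
    ∃ f, UnsatSigns G f := by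
  classical
  obtain ⟨S, hsimple, ⟨hnd, hS⟩, hun⟩ := h
  have hinj := List.inj_on_of_nodup_map hnd
  refine ⟨fun x y => decide (∃ s, ((x, true), (y, s)) ∈ S ∨ ((y, s), (x, true)) ∈ S),
    fun τ => ?_⟩
  have hτ : ¬ SatTwoCNF τ S := fun h => hun ⟨τ, h⟩
  simp only [SatTwoCNF, not_forall, not_or] at hτ
  obtain ⟨⟨⟨x, a⟩, ⟨y, b⟩⟩, hc, hx, hy⟩ := hτ
  have hne : x ≠ y := hsimple.1 _ hc
  have hadj : G.Adj x y := by
    rw [← SimpleGraph.mem_edgeSet, ← hS]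
    exact List.mem_map_of_mem (f := clauseVars) hc
  have key : ∀ a' b', ((x, a'), (y, b')) ∈ S → a' = a ∧ b' = b := fun a' b' h' => by
    have := hinj h' hc rfl
    simpa using this
  have key' : ∀ a' b', ((y, b'), (x, a')) ∉ S := fun a' b' h' => by
    have := hinj h' hc Sym2.eq_swap
    simp only [Prod.mk.injEq] at this
    exact hne this.2.1
  have hfx : decide (∃ s, ((x, true), (y, s)) ∈ S ∨ ((y, s), (x, true)) ∈ S) = a := by
    cases a
    · simp only [decide_eq_false_iff_not]
      rintro ⟨s, h | h⟩
      · simpa using (key _ _ h).1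
      · exact key' _ _ h
    · exact decide_eq_true ⟨b, Or.inl hc⟩
  have hfy : decide (∃ s, ((y, true), (x, s)) ∈ S ∨ ((x, s), (y, true)) ∈ S) = b := by
    cases b
    · simp only [decide_eq_false_iff_not]
      rintro ⟨s, h | h⟩
      · exact key' _ _ h
      · simpa using (key _ _ h).2
    · exact decide_eq_true ⟨a, Or.inr hc⟩
  exact ⟨x, y, hadj, fun h => hx (h.trans hfx), fun h => hy (h.trans hfy)⟩

theorem InU.of_unsatSigns {V : Type} {G : SimpleGraph V} (hfin : G.edgeSet.Finite)
    {f : V → V → Bool} (hf : UnsatSigns G f) : InU G := by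
  let g : Sym2 V → Lit V × Lit V := fun e =>
    (((Quot.out e).1, f (Quot.out e).1 (Quot.out e).2),
      ((Quot.out e).2, f (Quot.out e).2 (Quot.out e).1))
  have hg : ∀ e, clauseVars (g e) = e := fun e => Quot.out_eq e
  have hmap : (hfin.toFinset.toList.map g).map clauseVars = hfin.toFinset.toList := by
    rw [List.map_map]
    exact (List.map_congr_left fun e _ => hg e).trans (List.map_id _)
  have hnd : ((hfin.toFinset.toList.map g).map clauseVars).Nodup := by
    rw [hmap]
    exact Finset.nodup_toList _
  have hmem : ∀ e ∈ G.edgeSet, g e ∈ hfin.toFinset.toList.map g := fun e he =>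
    List.mem_map_of_mem (by simpa using he)
  refine ⟨hfin.toFinset.toList.map g, ⟨?_, hnd⟩, ⟨hnd, ?_⟩, ?_⟩
  · intro c hc
    obtain ⟨e, he, rfl⟩ := List.mem_map.1 hc
    have he' : clauseVars (g e) ∈ G.edgeSet := by
      rw [hg]
      simpa using he
    exact G.ne_of_adj he'
  · rw [hmap]
    ext e
    simp
  · rintro ⟨τ, hτ⟩
    obtain ⟨x, y, hxy, hx, hy⟩ := hf τ
    have hsat := hτ _ (hmem s(x, y) hxy)
    have hout := hg s(x, y)
    simp only [clauseVars, Sym2.eq_iff] at hout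
    simp only [g] at hsat hout
    rcases hout with ⟨h1, h2⟩ | ⟨h1, h2⟩ <;> rw [h1, h2] at hsat <;> tauto

theorem inU_iff {V : Type} (G : SimpleGraph V) :
    InU G ↔ G.edgeSet.Finite ∧ ∃ f, UnsatSigns G f :=
  ⟨fun h => ⟨h.finite_edgeSet, h.exists_unsatSigns⟩, fun ⟨hfin, _, hf⟩ => .of_unsatSigns hfin hf⟩

theorem InU.of_iso {V W : Type} {G : SimpleGraph V} {H : SimpleGraph W} (e : G ≃g H)
    (h : InU G) : InU H := by
  obtain ⟨hfin, f, hf⟩ := (inU_iff G).1 h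
  have : Finite G.edgeSet := hfin
  refine (inU_iff H).2 ⟨Finite.of_equiv _ e.mapEdgeSet, fun x y => f (e.symm x) (e.symm y),
    fun τ => ?_⟩
  obtain ⟨x, y, hxy, hx, hy⟩ := hf (τ ∘ e)
  exact ⟨e x, e y, e.map_adj_iff.2 hxy, by simpa using hx, by simpa using hy⟩

theorem inU_congr {V W : Type} {G : SimpleGraph V} {H : SimpleGraph W} (e : G ≃g H) :
    InU G ↔ InU H :=
  ⟨.of_iso e, .of_iso e.symm⟩

section Subdivide

variable {V : Type} {G : SimpleGraph V} {u v : V}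

theorem subdivideEdge_adj_some_some {x y : V} :
    (subdivideEdge G u v).Adj (some x) (some y) ↔ G.Adj x y ∧ s(x, y) ≠ s(u, v) := by
  simp only [subdivideEdge, SimpleGraph.fromRel_adj, G.adj_comm y x, Sym2.eq_swap (a := y), or_self]
  exact ⟨fun h => h.2, fun h => ⟨by simpa using h.1.ne, h⟩⟩

theorem subdivideEdge_adj_some_none {x : V} :
    (subdivideEdge G u v).Adj (some x) none ↔ x = u ∨ x = v := by
  simp [subdivideEdge, SimpleGraph.fromRel_adj]

theorem subdivideEdge_adj_none_some {x : V} :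
    (subdivideEdge G u v).Adj none (some x) ↔ x = u ∨ x = v := by
  rw [SimpleGraph.adj_comm, subdivideEdge_adj_some_none]

theorem finite_edgeSet_subdivideEdge (h : G.edgeSet.Finite) :
    (subdivideEdge G u v).edgeSet.Finite := by
  refine ((h.image (Sym2.map some)).union
    (Set.toFinite {s(some u, none), s(some v, none)})).subset ?_
  intro e
  induction e with | _ a b
  rw [SimpleGraph.mem_edgeSet]
  rcases a with _ | a <;> rcases b with _ | b <;> intro hab
  · exact absurd rfl hab.ne
  · rcases subdivideEdge_adj_none_some.1 hab with rfl | rfl <;> simp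
  · rcases subdivideEdge_adj_some_none.1 hab with rfl | rfl <;> simp
  · exact Or.inl ⟨s(a, b), (subdivideEdge_adj_some_some.1 hab).1, rfl⟩

theorem finite_edgeSet_of_subdivideEdge (h : (subdivideEdge G u v).edgeSet.Finite) :
    G.edgeSet.Finite := by
  refine ((h.preimage (Sym2.map.injective (Option.some_injective V)).injOn).union
    (Set.finite_singleton s(u, v))).subset ?_
  intro e
  induction e with | _ a b
  intro hab
  by_cases he : s(a, b) = s(u, v)
  · exact Or.inr he
  · exact Or.inl (subdivideEdge_adj_some_some.2 ⟨hab, he⟩)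

/-- The clause on `uv` is split into a clause on `uw` and a clause on `wv`, where the two literals
at the new vertex `w` are complementary. -/
theorem UnsatSigns.subdivideEdge {f : V → V → Bool} (huv : G.Adj u v) (hf : UnsatSigns G f) :
    ∃ f', UnsatSigns (subdivideEdge G u v) f' := by
  classical
  refine ⟨fun
    | some x, some y => f x y
    | some x, none => if x = u then f u v else f v u
    | none, some x => decide (x = u)
    | none, none => true, fun τ => ?_⟩
  have hne := huv.ne
  obtain ⟨x, y, hxy, hx, hy⟩ := hf (τ ∘ some)
  by_cases he : s(x, y) = s(u, v)
  · have huv' : τ (some u) ≠ f u v ∧ τ (some v) ≠ f v u := by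
      rcases Sym2.eq_iff.1 he with ⟨rfl, rfl⟩ | ⟨rfl, rfl⟩
      · exact ⟨hx, hy⟩
      · exact ⟨hy, hx⟩
    cases hw : τ none
    · exact ⟨some u, none, subdivideEdge_adj_some_none.2 (Or.inl rfl), by simpa using huv'.1,
        by simp [hw]⟩
    · exact ⟨some v, none, subdivideEdge_adj_some_none.2 (Or.inr rfl),
        by simpa [hne.symm] using huv'.2, by simp [hw, hne.symm]⟩
  · exact ⟨some x, some y, subdivideEdge_adj_some_some.2 ⟨hxy, he⟩, hx, hy⟩

/-- The two clauses at the new vertex `w` are replaced by a clause on `uv` formed by their literals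
at `u` and `v`. -/
theorem UnsatSigns.of_subdivideEdge {f : Option V → Option V → Bool} (huv : G.Adj u v)
    (hf : UnsatSigns (Sat2.subdivideEdge G u v) f) : ∃ f', UnsatSigns G f' := by
  classical
  let f' : V → V → Bool := fun x y =>
    if s(x, y) = s(u, v) then f (some x) none else f (some x) (some y)
  have hvu : f' v u = f (some v) none := if_pos Sym2.eq_swap
  have huv' : f' u v = f (some u) none := if_pos rfl
  refine ⟨f', fun τ => ?_⟩
  let b : Bool := if τ u = f (some u) none then f none (some v) else f none (some u)
  by_contra! hsat
  have hw : ∀ x, x = u ∨ x = v → τ x ≠ f (some x) none → b = f none (some x) := by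
    rintro x (rfl | rfl) hx
    · simp [b, hx]
    · have : τ u = f (some u) none := by
        by_contra hu
        exact hx (hvu ▸ hsat u x huv (by rwa [huv']))
      simp [b, this]
  obtain ⟨x, y, hxy, hx, hy⟩ := hf (fun z => z.elim b τ)
  rcases x with _ | x <;> rcases y with _ | y
  · exact SimpleGraph.irrefl _ hxy
  · exact hx (hw y (subdivideEdge_adj_none_some.1 hxy) hy)
  · exact hy (hw x (subdivideEdge_adj_some_none.1 hxy) hx)
  · obtain ⟨hadj, he⟩ := subdivideEdge_adj_some_some.1 hxy
    have hxy' : f' x y = f (some x) (some y) := if_neg he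
    have hyx' : f' y x = f (some y) (some x) := if_neg (by rwa [Sym2.eq_swap])
    exact hy (hyx' ▸ hsat x y hadj (by rwa [hxy']))

theorem inU_subdivideEdge_iff (huv : G.Adj u v) : InU (subdivideEdge G u v) ↔ InU G := by
  rw [inU_iff, inU_iff]
  exact ⟨fun ⟨hfin, _, hf⟩ => ⟨finite_edgeSet_of_subdivideEdge hfin, hf.of_subdivideEdge huv⟩,
    fun ⟨hfin, _, hf⟩ => ⟨finite_edgeSet_subdivideEdge hfin, hf.subdivideEdge huv⟩⟩

end Subdivide

theorem IsSubdivision.inU_iff {V W : Type} {G : SimpleGraph V} {H : SimpleGraph W}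
    (h : IsSubdivision G H) : InU G ↔ InU H := by
  induction h with
  | of_iso e => exact inU_congr e
  | step u v _ huv ih => exact ih.trans (inU_subdivideEdge_iff huv).symm

/-- If finite simple graphs `G` and `H` are homeomorphic (both isomorphic to
subdivisions of a common graph `K`), then `G ∈ 𝒰` iff `H ∈ 𝒰`. -/
theorem stmt_6 {α β : Type} [Fintype α] [Fintype β]
    (G : SimpleGraph α) (H : SimpleGraph β)
    (h : ∃ (γ γ₁ γ₂ : Type) (K : SimpleGraph γ)
        (G' : SimpleGraph γ₁) (H' : SimpleGraph γ₂),
      IsSubdivision K G' ∧ IsSubdivision K H' ∧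
        Nonempty (G ≃g G') ∧ Nonempty (H ≃g H')) :
    InU G ↔ InU H := by
  obtain ⟨γ, γ₁, γ₂, K, G', H', hG, hH, ⟨eG⟩, ⟨eH⟩⟩ := h
  rw [inU_congr eG, inU_congr eH, ← hG.inU_iff, ← hH.inU_iff]

end Sat2
end

section
/- For every natural number n ≥ 3, every simple 2-CNF supported on the cycle graph Cₙ on n vertices is satisfiable; that is, Cₙ ∉ 𝒰. -/
open SimpleGraph

namespace Sat2

/-- A 2-CNF is satisfiable if one can choose a literal in every clause so that distinct clauses
get literals with distinct underlying variables. -/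
theorem twoSatisfiable_of_injOn {V : Type} {S : TwoCNF V} (g : Lit V × Lit V → Lit V)
    (hg : ∀ c ∈ S, g c = c.1 ∨ g c = c.2) (hinj : Set.InjOn (fun c => (g c).1) {c | c ∈ S}) :
    TwoSatisfiable S := by
  classical
  let τ : V → Bool := fun x => decide (∃ c ∈ S, g c = (x, true))
  have key : ∀ c ∈ S, τ (g c).1 = (g c).2 := by
    intro c hc
    by_cases hb : (g c).2 = true
    · rw [hb]
      exact decide_eq_true ⟨c, hc, Prod.ext rfl hb⟩
    · rw [Bool.eq_false_iff.mpr hb]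
      refine decide_eq_false ?_
      rintro ⟨d, hd, hgd⟩
      have hdc : d = c := hinj hd hc (show (g d).1 = (g c).1 by rw [hgd])
      subst hdc
      exact hb (congrArg Prod.snd hgd)
  refine ⟨τ, fun c hc => ?_⟩
  have h := key c hc
  rcases hg c hc with hc' | hc' <;> rw [hc'] at h
  · exact Or.inl h
  · exact Or.inr h

/-- For every `n ≥ 3`, the cycle graph `Cₙ` is not in `𝒰`. -/
theorem stmt_11 (n : ℕ) (hn : 3 ≤ n) : ¬ InU (SimpleGraph.cycleGraph n) := by
  obtain ⟨m, rfl⟩ : ∃ m, n = m + 2 := ⟨n - 2, by omega⟩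
  rintro ⟨S, -, ⟨hnodup, hedges⟩, hunsat⟩
  let g : Lit (Fin (m + 2)) × Lit (Fin (m + 2)) → Lit (Fin (m + 2)) :=
    fun c => if c.2.1 = c.1.1 + 1 then c.1 else c.2
  have hvars : ∀ c ∈ S, clauseVars c = s((g c).1, (g c).1 + 1) := by
    intro c hc
    have hadj : clauseVars c ∈ (cycleGraph (m + 2)).edgeSet := by
      rw [← hedges]
      exact List.mem_map_of_mem hc
    rw [clauseVars, mem_edgeSet, cycleGraph_adj, sub_eq_iff_eq_add', sub_eq_iff_eq_add'] at hadj
    by_cases h : c.2.1 = c.1.1 + 1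
    · simp only [g, if_pos h, clauseVars, ← h]
    · have h' := hadj.resolve_right h
      simp only [g, if_neg h, clauseVars, ← h', Sym2.eq_swap]
  refine hunsat (twoSatisfiable_of_injOn g (fun c _ => ite_eq_or_eq _ _ _) ?_)
  intro c hc d hd hcd
  refine List.inj_on_of_nodup_map hnodup hc hd ?_
  rw [hvars c hc, hvars d hd]
  exact congrArg (fun x => s(x, x + 1)) hcd

end Sat2
end

section
/- Every simple 2-CNF supported on the graph K₄ − e (the complete graph on four vertices with one edge deleted) is satisfiable; that is, K₄ − e ∉ 𝒰. -/
open SimpleGraph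

namespace Sat2

/-- If distinct clauses have distinct variable pairs, then the constraint that a 2-CNF puts on a given
pair of variables is implied by a single disjunction. -/
theorem exists_clause_on_pair {V : Type} {S : TwoCNF V} (hS : (S.map clauseVars).Nodup) (u v : V) :
    ∃ s t : Bool, ∀ c ∈ S, clauseVars c = s(u, v) → ∀ τ : V → Bool, (τ u = s ∨ τ v = t) →
      (τ c.1.1 = c.1.2 ∨ τ c.2.1 = c.2.2) := by
  by_cases h : ∃ c ∈ S, clauseVars c = s(u, v)
  · obtain ⟨c, hc, hcv⟩ := h
    have huniq : ∀ d ∈ S, clauseVars d = s(u, v) → d = c := fun d hd hdv =>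
      List.inj_on_of_nodup_map hS hd hc (hdv.trans hcv.symm)
    obtain ⟨⟨x, a⟩, ⟨y, b⟩⟩ := c
    rcases Sym2.eq_iff.mp hcv with ⟨rfl, rfl⟩ | ⟨rfl, rfl⟩
    · exact ⟨a, b, fun d hd hdv τ hτ => by rw [huniq d hd hdv]; exact hτ⟩
    · exact ⟨b, a, fun d hd hdv τ hτ => by rw [huniq d hd hdv]; exact hτ.symm⟩
  · push Not at h
    exact ⟨true, true, fun c hc hcv => absurd hcv (h c hc)⟩

/-- A path of two 2-clauses `x – z – y` excludes at most one pair of values for its endpoints. -/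
theorem exists_excluded_endpoints : ∀ a b c d : Bool, ∃ p q : Bool, ∀ x y : Bool,
    (x ≠ p ∨ y ≠ q) → ∃ z : Bool, (x = a ∨ z = b) ∧ (y = c ∨ z = d) := by
  decide

/-- A 2-clause and two further excluded pairs leave some pair of values available. -/
theorem exists_avoiding_pair : ∀ s t p q p' q' : Bool, ∃ x y : Bool,
    (x = s ∨ y = t) ∧ (x ≠ p ∨ y ≠ q) ∧ (x ≠ p' ∨ y ≠ q') := by
  decide

/-- The graph `K₄ − e` is not in `𝒰`: every simple 2-CNF supported on it is
satisfiable. -/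
theorem stmt_12 : ¬ InU K4minusE := by
  rintro ⟨S, -, ⟨hnodup, hedges⟩, hunsat⟩
  obtain ⟨s, t, h01⟩ := exists_clause_on_pair hnodup 0 1
  obtain ⟨a, b, h02⟩ := exists_clause_on_pair hnodup 0 2
  obtain ⟨c, d, h12⟩ := exists_clause_on_pair hnodup 1 2
  obtain ⟨a', b', h03⟩ := exists_clause_on_pair hnodup 0 3
  obtain ⟨c', d', h13⟩ := exists_clause_on_pair hnodup 1 3
  obtain ⟨p, q, hpq⟩ := exists_excluded_endpoints a b c d
  obtain ⟨p', q', hpq'⟩ := exists_excluded_endpoints a' b' c' d'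
  obtain ⟨x, y, hxy, hx, hx'⟩ := exists_avoiding_pair s t p q p' q'
  obtain ⟨z, hz0, hz1⟩ := hpq x y hx
  obtain ⟨w, hw0, hw1⟩ := hpq' x y hx'
  refine hunsat ⟨![x, y, z, w], fun e he => ?_⟩
  have hmem : clauseVars e ∈ K4minusE.edgeSet :=
    hedges ▸ List.mem_map_of_mem he
  rw [K4minusE, SimpleGraph.edgeSet_fromEdgeSet] at hmem
  rcases hmem.1 with h | h | h | h | h
  · exact h01 e he h _ hxy
  · exact h02 e he h _ hz0
  · exact h03 e he h _ hw0
  · exact h12 e he h _ hz1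
  · exact h13 e he h _ hw1

end Sat2
end

section
/- No finite tree (a finite connected acyclic simple graph) is in 𝒰; equivalently, every simple 2-CNF supported on a finite tree is satisfiable. -/
open SimpleGraph

namespace Sat2

/-- In a tree, a vertex has at most one neighbour closer to a given root. -/
lemma eq_of_adj_of_dist_eq_add_one {V : Type} {G : SimpleGraph V} (hG : G.IsTree) {r v w w' : V}
    (hw : G.Adj w v) (hd : G.dist r v = G.dist r w + 1)
    (hw' : G.Adj w' v) (hd' : G.dist r v = G.dist r w' + 1) : w = w' := by
  have exists_path {x : V} (hx : G.Adj x v) (hdx : G.dist r v = G.dist r x + 1) :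
      ∃ p : G.Walk r v, p.IsPath ∧ p.penultimate = x := by
    obtain ⟨p, hp⟩ := hG.connected.exists_walk_length_eq_dist r x
    exact ⟨p.concat hx, Walk.isPath_of_length_eq_dist _ (by simp [hp, hdx]), by simp⟩
  obtain ⟨p, hp, rfl⟩ := exists_path hw hd
  obtain ⟨q, hq, rfl⟩ := exists_path hw' hd'
  rw [(hG.existsUnique_path r v).unique hp hq]

/-- Every 2-CNF supported on a tree is satisfiable. -/
lemma SupportedOn.twoSatisfiable {V : Type} {G : SimpleGraph V} {S : TwoCNF V}
    (hS : SupportedOn S G) (hG : G.IsTree) : TwoSatisfiable S := by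
  classical
  obtain ⟨hnodup, hedges⟩ := hS
  obtain ⟨r⟩ := hG.connected.nonempty
  have hadj : ∀ c ∈ S, G.Adj c.1.1 c.2.1 := fun c hc ↦ by
    rw [← mem_edgeSet, ← hedges]
    exact List.mem_map_of_mem (f := clauseVars) hc
  have hinj := List.inj_on_of_nodup_map hnodup
  -- `Forced v s`: the clause on the edge from `v` towards the root contains the literal `(v, s)`
  let Forced (v : V) (s : Bool) : Prop := ∃ l : Lit V,
    (((v, s), l) ∈ S ∨ (l, (v, s)) ∈ S) ∧ G.dist r v = G.dist r l.1 + 1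
  have forced_unique {v : V} {s t : Bool} (hs : Forced v s) (ht : Forced v t) : s = t := by
    obtain ⟨⟨w, a⟩, h, hd⟩ := hs
    obtain ⟨⟨w', b⟩, h', hd'⟩ := ht
    have hw : G.Adj w v := h.elim (fun h ↦ (hadj _ h).symm) (hadj _)
    have hw' : G.Adj w' v := h'.elim (fun h ↦ (hadj _ h).symm) (hadj _)
    obtain rfl := eq_of_adj_of_dist_eq_add_one hG hw hd hw' hd'
    have hne := hw.ne
    rcases h with h | h <;> rcases h' with h' | h'
    · exact congrArg (·.1.2) (hinj h h' rfl)
    · exact absurd (congrArg (·.1.1) (hinj h h' Sym2.eq_swap)).symm hne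
    · exact absurd (congrArg (·.1.1) (hinj h h' Sym2.eq_swap)) hne
    · exact congrArg (·.2.2) (hinj h h' rfl)
  have forced_sat {v : V} {s : Bool} (h : Forced v s) : decide (Forced v true) = s := by
    cases s with
    | true => exact decide_eq_true h
    | false => exact decide_eq_false fun h' ↦ Bool.noConfusion (forced_unique h h')
  refine ⟨fun v ↦ decide (Forced v true), fun c hc ↦ ?_⟩
  rcases hG.dist_eq_dist_add_one_of_adj r (hadj c hc) with hd | hd
  · exact .inl (forced_sat ⟨c.2, .inl hc, hd⟩)
  · exact .inr (forced_sat ⟨c.1, .inr hc, hd⟩)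

/-- No finite tree is in `𝒰`. -/
theorem stmt_13 {α : Type} [Fintype α] (G : SimpleGraph α)
    (hG : G.IsTree) : ¬ InU G := by
  rintro ⟨S, -, hS, hunsat⟩
  exact hunsat (hS.twoSatisfiable hG)

end Sat2
end

section
/- Every finite connected simple graph G with at least two independent cycles (that is, with |E(G)| ≥ |V(G)| + 1) has at least one of the following three graphs as a topological minor: the bowtie (two vertex-disjoint triangles joined by a single edge), the butterfly (two triangles sharing exactly one vertex), or K₄ − e (the complete graph on four vertices with one edge deleted). -/
open SimpleGraph

namespace Sat2

theorem IsTopMinor.of_isSubgraphOf {α β : Type} {K : SimpleGraph α} {G : SimpleGraph β}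
    (h : IsSubgraphOf K G) : IsTopMinor K G :=
  ⟨α, K, .of_iso Iso.refl, h⟩

theorem IsTopMinor.trans_isSubgraphOf {α β γ : Type} {K : SimpleGraph α} {H : SimpleGraph β}
    {G : SimpleGraph γ} (h : IsTopMinor K H) (hG : IsSubgraphOf H G) : IsTopMinor K G := by
  obtain ⟨δ, K', hK, f, hf, hadj⟩ := h
  obtain ⟨g, hg, hadj'⟩ := hG
  exact ⟨δ, K', hK, g ∘ f, hg.comp hf, fun _ _ huv => hadj' (hadj huv)⟩

/-- Suppressing a vertex `v` with neighbours `a` and `b`, that is, replacing the path `a – v – b`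
by the edge `(a, b)`, produces no new topological minors. -/
theorem IsTopMinor.of_suppress {α β : Type} {K : SimpleGraph β} {G : SimpleGraph α} {v a b : α}
    {s : Set α} (hv : v ∉ s) {H : SimpleGraph s} (h : IsTopMinor K H)
    (ha : G.Adj v a) (hb : G.Adj v b)
    (hH : ∀ x y : s, H.Adj x y → G.Adj x y ∨ s((x : α), (y : α)) = s(a, b)) :
    IsTopMinor K G := by
  obtain ⟨γ, K', hK, f, hf, hadj⟩ := h
  by_cases hpq : ∃ p q, K'.Adj p q ∧ (f p : α) = a ∧ (f q : α) = b
  · obtain ⟨p, q, hpq, hp, hq⟩ := hpq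
    refine ⟨Option γ, subdivideEdge K' p q, .step p q hK hpq,
      fun o => o.elim v (fun c => (f c : α)), ?_, ?_⟩
    · rintro (_ | x) (_ | y) hxy
      · rfl
      · exact absurd ((show v = f y from hxy) ▸ (f y).2) hv
      · exact absurd ((show (f x : α) = v from hxy) ▸ (f x).2) hv
      · exact congrArg some (hf (Subtype.ext hxy))
    · have key : ∀ x y, K'.Adj x y → s(x, y) ≠ s(p, q) → G.Adj (f x) (f y) := by
        intro x y hxy hne
        refine (hH _ _ (hadj hxy)).resolve_right fun he => hne ?_
        rw [← hp, ← hq] at he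
        exact Sym2.map.injective (Subtype.val_injective.comp hf) he
      rintro (_ | x) (_ | y) hxy
      · simp [subdivideEdge] at hxy
      · simp only [subdivideEdge, fromRel_adj] at hxy
        rcases hxy.2 with h | rfl | rfl
        · exact h.elim
        · simpa [hp] using ha
        · simpa [hq] using hb
      · simp only [subdivideEdge, fromRel_adj] at hxy
        rcases hxy.2 with (rfl | rfl) | h
        · simpa [hp] using ha.symm
        · simpa [hq] using hb.symm
        · exact h.elim
      · simp only [subdivideEdge, fromRel_adj] at hxy
        rcases hxy.2 with ⟨h, hne⟩ | ⟨h, hne⟩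
        · exact key x y h hne
        · exact (key y x h hne).symm
  · refine ⟨γ, K', hK, fun c => (f c : α), Subtype.val_injective.comp hf, fun x y hxy => ?_⟩
    refine (hH _ _ (hadj hxy)).resolve_right fun he => hpq ?_
    rcases Sym2.eq_iff.1 he with ⟨h1, h2⟩ | ⟨h1, h2⟩
    · exact ⟨x, y, hxy, h1, h2⟩
    · exact ⟨y, x, hxy.symm, h2, h1⟩

theorem isSubgraphOf_butterfly {α : Type} {G : SimpleGraph α} {x p p' q q' : α}
    (hnd : [p, p', x, q, q'].Nodup) (h1 : G.Adj x p) (h2 : G.Adj x p') (h3 : G.Adj p p')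
    (h4 : G.Adj x q) (h5 : G.Adj x q') (h6 : G.Adj q q') : IsSubgraphOf butterfly G := by
  refine ⟨[p, p', x, q, q'].get, List.nodup_iff_injective_get.1 hnd, fun u v huv => ?_⟩
  fin_cases u <;> fin_cases v <;> simp [butterfly] at huv ⊢ <;>
    first | assumption | (apply Adj.symm; assumption)

theorem isSubgraphOf_bowtie {α : Type} {G : SimpleGraph α} {x y p q r s : α}
    (hnd : [p, q, x, y, r, s].Nodup) (hxy : G.Adj x y) (h1 : G.Adj x p) (h2 : G.Adj x q)
    (h3 : G.Adj p q) (h4 : G.Adj y r) (h5 : G.Adj y s) (h6 : G.Adj r s) :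
    IsSubgraphOf bowtie G := by
  refine ⟨[p, q, x, y, r, s].get, List.nodup_iff_injective_get.1 hnd, fun u v huv => ?_⟩
  fin_cases u <;> fin_cases v <;> simp [bowtie] at huv ⊢ <;>
    first | assumption | (apply Adj.symm; assumption)

theorem isSubgraphOf_K4minusE {α : Type} {G : SimpleGraph α} {x y p q : α}
    (hpq : p ≠ q) (hxy : G.Adj x y) (h1 : G.Adj x p) (h2 : G.Adj x q)
    (h3 : G.Adj y p) (h4 : G.Adj y q) : IsSubgraphOf K4minusE G := by
  have hnd : [x, y, p, q].Nodup := by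
    simp [hpq, hxy.ne, h1.ne, h2.ne, h3.ne, h4.ne]
  refine ⟨[x, y, p, q].get, List.nodup_iff_injective_get.1 hnd, fun u v huv => ?_⟩
  fin_cases u <;> fin_cases v <;> simp [K4minusE] at huv ⊢ <;>
    first | assumption | (apply Adj.symm; assumption)

section DegreeTwo

variable {α : Type} {G : SimpleGraph α}

/-- A vertex has exactly two neighbours, and these are adjacent. -/
def IsTriangleTip (G : SimpleGraph α) (v : α) : Prop :=
  ∃ a b, a ≠ b ∧ G.Adj a b ∧ ∀ w, G.Adj v w ↔ w = a ∨ w = b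

theorem IsTriangleTip.exists_common_neighbor {p x : α} (hp : IsTriangleTip G p)
    (hx : G.Adj p x) : ∃ p', p' ≠ x ∧ G.Adj x p' ∧ ∀ w, G.Adj p w ↔ w = x ∨ w = p' := by
  obtain ⟨a, b, hab, hadj, hN⟩ := hp
  rcases (hN x).1 hx with rfl | rfl
  · exact ⟨b, hab.symm, hadj, hN⟩
  · exact ⟨a, hab, hadj.symm, fun w => by rw [hN, or_comm]⟩

theorem exists_butterfly {x : α} [Fintype (G.neighborSet x)] (hx : 4 ≤ G.degree x)
    (h : ∀ v, v ≠ x → IsTriangleTip G v) : IsSubgraphOf butterfly G := by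
  classical
  obtain ⟨p, hp⟩ : (G.neighborFinset x).Nonempty := by
    rw [← Finset.card_pos, card_neighborFinset_eq_degree]; omega
  rw [mem_neighborFinset] at hp
  obtain ⟨p', hpx, hxp, hNp⟩ := (h p hp.ne').exists_common_neighbor hp.symm
  have hpp : G.Adj p p' := (hNp p').2 (.inr rfl)
  obtain ⟨q, hq, hq'⟩ : ∃ q ∈ G.neighborFinset x, q ∉ ({p, p'} : Finset α) := by
    refine Finset.exists_mem_notMem_of_card_lt_card ?_
    rw [card_neighborFinset_eq_degree]
    exact (Finset.card_le_two).trans_lt (by omega)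
  rw [mem_neighborFinset] at hq
  obtain ⟨q', hqx, hxq, hNq⟩ := (h q hq.ne').exists_common_neighbor hq.symm
  obtain ⟨p'', -, -, hNp'⟩ := (h p' hpx).exists_common_neighbor hxp.symm
  have hqq : G.Adj q q' := (hNq q').2 (.inr rfl)
  have e1 : p = p'' := ((hNp' p).1 hpp.symm).resolve_left hp.ne'
  simp only [Finset.mem_insert, Finset.mem_singleton, not_or] at hq'
  have e2 : q' ≠ p := by
    rintro rfl
    rcases (hNp q).1 hqq.symm with e | e
    · exact hq.ne' e
    · exact hq'.2 e
  have e3 : q' ≠ p' := by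
    rintro rfl
    rcases (hNp' q).1 hqq.symm with e | e
    · exact hq.ne' e
    · exact hq'.1 (e.trans e1.symm)
  refine isSubgraphOf_butterfly ?_ hp hxp hpp hq hxq hqq
  simp [hpp.ne, hp.ne', hpx, hq.ne, hqx.symm, hqq.ne, e2.symm, e3.symm, Ne.symm hq'.1,
    Ne.symm hq'.2]

/-- If the three neighbours of `x` are `y`, `p`, `q`, where `p` and `q` have degree two and lie on
triangles, then those triangles share the edge `(x, y)` or coincide. -/
theorem K4minusE_or_adj {x y p q : α} (hxy : G.Adj x y) (hpq : p ≠ q)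
    (hN : ∀ w, G.Adj x w ↔ w = y ∨ w = p ∨ w = q)
    (hp : IsTriangleTip G p) (hq : IsTriangleTip G q) :
    IsSubgraphOf K4minusE G ∨ G.Adj p q := by
  have hxp : G.Adj x p := (hN p).2 (by simp)
  have hxq : G.Adj x q := (hN q).2 (by simp)
  obtain ⟨p', hpx, hxp', hNp⟩ := hp.exists_common_neighbor hxp.symm
  obtain ⟨q', hqx, hxq', hNq⟩ := hq.exists_common_neighbor hxq.symm
  have hpp : G.Adj p p' := (hNp p').2 (.inr rfl)
  have hqq : G.Adj q q' := (hNq q').2 (.inr rfl)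
  rcases (hN p').1 hxp' with rfl | rfl | rfl
  · rcases (hN q').1 hxq' with rfl | rfl | rfl
    · exact .inl (isSubgraphOf_K4minusE hpq hxy hxp hxq hpp.symm hqq.symm)
    · exact .inr hqq.symm
    · exact absurd rfl hqq.ne
  · exact absurd rfl hpp.ne
  · exact .inr hpp

theorem exists_bowtie_or_K4minusE {x y : α} [Fintype (G.neighborSet x)]
    [Fintype (G.neighborSet y)] (hne : x ≠ y) (hx : G.degree x = 3) (hy : G.degree y = 3)
    (h : ∀ v, v ≠ x → v ≠ y → IsTriangleTip G v) :
    IsSubgraphOf bowtie G ∨ IsSubgraphOf K4minusE G := by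
  classical
  have nbrs : ∀ {x y : α} [Fintype (G.neighborSet x)], G.degree x = 3 → G.Adj x y →
      ∃ p q, p ≠ q ∧ p ≠ y ∧ q ≠ y ∧ ∀ w, G.Adj x w ↔ w = y ∨ w = p ∨ w = q := by
    intro x y _ hx hxy
    have hc : ((G.neighborFinset x).erase y).card = 2 := by
      rw [Finset.card_erase_of_mem (by simpa using hxy), card_neighborFinset_eq_degree, hx]
    obtain ⟨p, q, hpq, hs⟩ := Finset.card_eq_two.1 hc
    have hs' : ∀ w, (w ≠ y ∧ G.Adj x w) ↔ (w = p ∨ w = q) := fun w => by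
      simpa using Finset.ext_iff.1 hs w
    refine ⟨p, q, hpq, ((hs' p).2 (.inl rfl)).1, ((hs' q).2 (.inr rfl)).1, fun w => ?_⟩
    rw [← hs' w]
    by_cases hw : w = y
    · simp [hw, hxy]
    · simp [hw]
  by_cases hxy : G.Adj x y
  · obtain ⟨p, q, hpq, hpy, hqy, hNx⟩ := nbrs hx hxy
    obtain ⟨r, s, hrs, hrx, hsx, hNy⟩ := nbrs hy hxy.symm
    have hxp : G.Adj x p := (hNx p).2 (by simp)
    have hxq : G.Adj x q := (hNx q).2 (by simp)
    have hyr : G.Adj y r := (hNy r).2 (by simp)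
    have hys : G.Adj y s := (hNy s).2 (by simp)
    have tp := h p hxp.ne' hpy
    have tq := h q hxq.ne' hqy
    rcases K4minusE_or_adj hxy hpq hNx tp tq with hk | apq
    · exact .inr hk
    rcases K4minusE_or_adj hxy.symm hrs hNy (h r hrx hyr.ne') (h s hsx hys.ne') with hk | ars
    · exact .inr hk
    have notAdj : ∀ {p q}, IsTriangleTip G p → G.Adj x p → G.Adj p q → q ≠ x → q ≠ y →
        ¬ G.Adj y p := by
      intro p q tp hxp apq hqx hqy hyp
      obtain ⟨p', -, -, hN⟩ := tp.exists_common_neighbor hxp.symm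
      have e1 := ((hN q).1 apq).resolve_left hqx
      have e2 := ((hN y).1 hyp.symm).resolve_left hxy.ne'
      exact hqy (e1.trans e2.symm)
    have np := notAdj tp hxp apq hxq.ne' hqy
    have nq := notAdj tq hxq apq.symm hxp.ne' hpy
    have pr : p ≠ r := by rintro rfl; exact np hyr
    have ps : p ≠ s := by rintro rfl; exact np hys
    have qr : q ≠ r := by rintro rfl; exact nq hyr
    have qs : q ≠ s := by rintro rfl; exact nq hys
    refine .inl (isSubgraphOf_bowtie ?_ hxy hxp hxq apq hyr hys ars)
    simp [hpq, hxp.ne', hpy, pr, ps, hxq.ne', hqy, qr, qs, hne, hrx.symm, hsx.symm, hyr.ne,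
      hys.ne, hrs]
  · exfalso
    obtain ⟨r, hr⟩ : (G.neighborFinset x).Nonempty := by
      rw [← Finset.card_pos, card_neighborFinset_eq_degree]; omega
    rw [mem_neighborFinset] at hr
    obtain ⟨p, q, hpq, hpr, hqr, hN⟩ := nbrs hx hr
    have hxp : G.Adj x p := (hN p).2 (by simp)
    have hxq : G.Adj x q := (hN q).2 (by simp)
    have tip : ∀ {w}, G.Adj x w → IsTriangleTip G w := fun {w} hw =>
      h w hw.ne' (by rintro rfl; exact hxy hw)
    obtain ⟨p', hpx, hxp', hNp⟩ := (tip hxp).exists_common_neighbor hxp.symm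
    obtain ⟨q', hqx, hxq', hNq⟩ := (tip hxq).exists_common_neighbor hxq.symm
    obtain ⟨r', hrx, hxr', hNr⟩ := (tip hr).exists_common_neighbor hr.symm
    have := hNp p'
    have := hNq q'
    have := hNr r'
    have := (hN p').1 hxp'
    have := (hN q').1 hxq'
    have := (hN r').1 hxr'
    have := hxp.ne
    have := hxq.ne
    have := hr.ne
    have hs := fun a b => G.adj_comm a b
    have hl := fun a => G.irrefl (v := a)
    grind

end DegreeTwo

/-- Every finite simple graph, connected or not, with more edges than vertices has the bowtie, the
butterfly or `K₄ − e` as a topological minor. -/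
theorem exists_topMinor_of_card_lt (n : ℕ) : ∀ {α : Type} [Fintype α] (G : SimpleGraph α),
    Fintype.card α = n → n + 1 ≤ G.edgeSet.ncard →
    IsTopMinor bowtie G ∨ IsTopMinor butterfly G ∨ IsTopMinor K4minusE G := by
  classical
  induction n with
  | zero =>
    intro α _ G hα hE
    have := Fintype.card_eq_zero_iff.1 hα
    simp [Set.eq_empty_of_isEmpty] at hE
  | succ n ih =>
    intro α _ G₀ hα hE₀
    obtain ⟨G, hle, hE⟩ : ∃ G ≤ G₀, G.edgeSet.ncard = n + 2 := by
      rw [← coe_edgeFinset, Set.ncard_coe_finset] at hE₀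
      obtain ⟨T, hT, hc⟩ := Finset.exists_subset_card_eq hE₀
      have hTE : (fromEdgeSet (T : Set (Sym2 α))).edgeSet = T := by
        rw [edgeSet_fromEdgeSet]
        refine sdiff_eq_left.2 (Set.disjoint_left.2 fun e he hd => ?_)
        exact G₀.not_isDiag_of_mem_edgeFinset (hT he) hd
      refine ⟨fromEdgeSet T, ?_, ?_⟩
      · rw [← edgeSet_subset_edgeSet, hTE]
        exact fun e he => mem_edgeFinset.1 (hT he)
      · rw [hTE, Set.ncard_coe_finset, hc]
    rw [← coe_edgeFinset, Set.ncard_coe_finset] at hE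
    suffices hG : IsTopMinor bowtie G ∨ IsTopMinor butterfly G ∨ IsTopMinor K4minusE G by
      have hs : IsSubgraphOf G G₀ := ⟨id, Function.injective_id, fun _ _ h => hle h⟩
      exact hG.imp (·.trans_isSubgraphOf hs)
        (Or.imp (·.trans_isSubgraphOf hs) (·.trans_isSubgraphOf hs))
    have hcard (v : α) : Fintype.card ({v}ᶜ : Set α) = n := by
      rw [Fintype.card_compl_set, hα]; simp
    have hedge (v : α) : (G.induce {v}ᶜ).edgeFinset.card = n + 2 - G.degree v := by
      rw [card_edgeFinset_induce_compl_singleton, card_edgeFinset_deleteIncidenceSet, hE]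
    by_cases hdeg : ∃ v, G.degree v ≤ 1
    · obtain ⟨v, hv⟩ := hdeg
      have hs : IsSubgraphOf (G.induce {v}ᶜ) G :=
        ⟨Subtype.val, Subtype.val_injective, fun _ _ h => h⟩
      refine (ih (G.induce {v}ᶜ) (hcard v) ?_).imp (·.trans_isSubgraphOf hs)
        (Or.imp (·.trans_isSubgraphOf hs) (·.trans_isSubgraphOf hs))
      rw [← coe_edgeFinset, Set.ncard_coe_finset, hedge]
      omega
    by_cases htri : ∃ v a b, a ≠ b ∧ ¬ G.Adj a b ∧ G.neighborFinset v = {a, b}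
    · obtain ⟨v, a, b, hab, hnadj, hN⟩ := htri
      have hN' : ∀ w, G.Adj v w ↔ w = a ∨ w = b := fun w => by
        rw [← mem_neighborFinset, hN]; simp
      have ha := (hN' a).2 (.inl rfl)
      have hb := (hN' b).2 (.inr rfl)
      have hdv : G.degree v = 2 := by
        rw [← card_neighborFinset_eq_degree, hN, Finset.card_pair hab]
      let a' : ({v}ᶜ : Set α) := ⟨a, ha.ne'⟩
      let b' : ({v}ᶜ : Set α) := ⟨b, hb.ne'⟩
      have hs : ∀ {β : Type} {K : SimpleGraph β}, IsTopMinor K (G.induce {v}ᶜ ⊔ edge a' b') →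
          IsTopMinor K G := by
        intro β K hK
        refine hK.of_suppress (by simp) ha hb fun x y hxy => ?_
        rw [sup_adj, edge_adj] at hxy
        rcases hxy with h | ⟨⟨rfl, rfl⟩ | ⟨rfl, rfl⟩, -⟩
        · exact .inl h
        · exact .inr rfl
        · exact .inr Sym2.eq_swap
      refine (ih (G.induce {v}ᶜ ⊔ edge a' b') (hcard v) ?_).imp hs (Or.imp hs hs)
      rw [← coe_edgeFinset, Set.ncard_coe_finset, card_edgeFinset_sup_edge, hedge, hdv]
      · omega
      · exact hnadj
      · exact fun h => hab (congrArg Subtype.val h)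
    push Not at hdeg htri
    have tip : ∀ v, G.degree v - 2 = 0 → IsTriangleTip G v := by
      intro v hv
      have h2 : (G.neighborFinset v).card = 2 := by
        have := hdeg v
        rw [card_neighborFinset_eq_degree]; omega
      obtain ⟨a, b, hab, hN⟩ := Finset.card_eq_two.1 h2
      refine ⟨a, b, hab, ?_, fun w => by rw [← mem_neighborFinset, hN]; simp⟩
      by_contra hnadj
      exact htri v a b hab hnadj hN
    have hsum : ∑ v, (G.degree v - 2) = 2 := by
      have h1 : ∑ v, (G.degree v - 2) + ∑ _v : α, 2 = ∑ v, G.degree v := by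
        rw [← Finset.sum_add_distrib]
        exact Finset.sum_congr rfl fun v _ => Nat.sub_add_cancel (hdeg v)
      rw [sum_degrees_eq_twice_card_edges, hE, Finset.sum_const, Finset.card_univ, hα,
        smul_eq_mul] at h1
      omega
    have hsub (T : Finset α) : ∑ v ∈ T, (G.degree v - 2) ≤ 2 :=
      (Finset.sum_le_sum_of_subset (Finset.subset_univ T)).trans_eq hsum
    obtain ⟨x, -, hx⟩ := Finset.exists_ne_zero_of_sum_ne_zero (hsum.trans_ne two_ne_zero)
    by_cases hx4 : 4 ≤ G.degree x
    · refine .inr (.inl (.of_isSubgraphOf (exists_butterfly hx4 fun v hv => tip v ?_)))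
      have := hsub {v, x}
      rw [Finset.sum_pair hv] at this
      omega
    · obtain ⟨y, hy, hyd⟩ : ∃ y ∈ Finset.univ.erase x, G.degree y - 2 ≠ 0 := by
        refine Finset.exists_ne_zero_of_sum_ne_zero fun h0 => ?_
        have := Finset.add_sum_erase Finset.univ (fun v => G.degree v - 2) (Finset.mem_univ x)
        simp only [h0, hsum] at this
        omega
      have hyx : x ≠ y := (Finset.ne_of_mem_erase hy).symm
      have h2 := hsub {x, y}
      rw [Finset.sum_pair hyx] at h2
      have htip : ∀ v, v ≠ x → v ≠ y → IsTriangleTip G v := by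
        refine fun v hvx hvy => tip v ?_
        have h3 := hsub {v, x, y}
        rw [Finset.sum_insert (by simp [hvx, hvy]), Finset.sum_pair hyx] at h3
        omega
      rcases exists_bowtie_or_K4minusE hyx (by omega) (by omega) htip with h | h
      · exact .inl (.of_isSubgraphOf h)
      · exact .inr (.inr (.of_isSubgraphOf h))

/-- Every finite connected simple graph with at least two independent cycles
(`|E(G)| ≥ |V(G)| + 1`) has the bowtie, the butterfly or `K₄ − e` as a
topological minor. -/
theorem stmt_14 {α : Type} [Fintype α] (G : SimpleGraph α)
    (hconn : G.Connected)
    (hcyc : Fintype.card α + 1 ≤ G.edgeSet.ncard) :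
    IsTopMinor bowtie G ∨ IsTopMinor butterfly G ∨ IsTopMinor K4minusE G :=
  exists_topMinor_of_card_lt _ G rfl hcyc

end Sat2
end

section
/- Every finite connected simple graph G with at least three independent cycles (that is, with |E(G)| ≥ |V(G)| + 2) is in 𝒰; that is, G supports an unsatisfiable simple 2-CNF. -/
open SimpleGraph

namespace Sat2

/-- `G` is refutable when every edge can be given a forbidden pair of values (the edge `uv`
forbids `τ u = f u v ∧ τ v = f v u`) such that every assignment meets a forbidden pair. -/
def Refutable {α : Type} (G : SimpleGraph α) : Prop :=
  ∃ f : α → α → Bool, ∀ τ : α → Bool, ∃ u v, G.Adj u v ∧ τ u = f u v ∧ τ v = f v u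

theorem Refutable.mono {α : Type} {G H : SimpleGraph α} (h : G ≤ H) (hG : Refutable G) :
    Refutable H := by
  obtain ⟨f, hf⟩ := hG
  refine ⟨f, fun τ => ?_⟩
  obtain ⟨u, v, huv, h1⟩ := hf τ
  exact ⟨u, v, h huv, h1⟩

theorem Refutable.inU {α : Type} [Finite α] {G : SimpleGraph α} (hG : Refutable G) : InU G := by
  classical
  have := Fintype.ofFinite α
  obtain ⟨f, hf⟩ := hG
  let clause : Sym2 α → Lit α × Lit α := fun e =>
    ((e.out.1, !f e.out.1 e.out.2), (e.out.2, !f e.out.2 e.out.1))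
  have hvars : ∀ e, clauseVars (clause e) = e := fun e => Quot.out_eq e
  have hmap : (G.edgeFinset.toList.map clause).map clauseVars = G.edgeFinset.toList := by
    rw [List.map_map]
    exact (List.map_congr_left fun e _ => hvars e).trans (List.map_id _)
  have hnodup : ((G.edgeFinset.toList.map clause).map clauseVars).Nodup := by
    rw [hmap]; exact Finset.nodup_toList _
  refine ⟨G.edgeFinset.toList.map clause, ⟨?_, hnodup⟩, ⟨hnodup, ?_⟩, ?_⟩
  · intro c hc
    obtain ⟨e, he, rfl⟩ := List.mem_map.1 hc
    have he' : e ∈ G.edgeSet := by simpa using he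
    rw [← hvars e] at he'
    exact G.ne_of_adj he'
  · rw [hmap]; ext e; simp
  · rintro ⟨τ, hτ⟩
    obtain ⟨u, v, huv, h1, h2⟩ := hf τ
    have hc := hτ (clause s(u, v)) (List.mem_map.2 ⟨s(u, v), by simpa using huv, rfl⟩)
    have hout : s((s(u, v) : Sym2 α).out.1, (s(u, v) : Sym2 α).out.2) = s(u, v) := hvars s(u, v)
    rcases Sym2.eq_iff.1 hout with ⟨ha, hb⟩ | ⟨ha, hb⟩ <;>
      simp [clause, ha, hb, h1, h2] at hc

/-- A graph containing a non-bridge `xy` connected to `r` can force a value of `r`. -/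
theorem exists_forcing {α : Type} (H : SimpleGraph α) {r x y : α} (hxy : H.Adj x y)
    (hx : (H.deleteEdges {s(x, y)}).Reachable x r)
    (hy : (H.deleteEdges {s(x, y)}).Reachable y r) (b : Bool) :
    ∃ f : α → α → Bool, ∀ τ : α → Bool, τ r = b →
      ∃ u v, H.Adj u v ∧ τ u = f u v ∧ τ v = f v u := by
  classical
  set D := H.deleteEdges {s(x, y)} with hD
  refine ⟨fun u v => if s(u, v) = s(x, y) then b else if D.dist u r < D.dist v r then b else !b,
    fun τ hr => ?_⟩
  by_contra! hno
  have key : ∀ n z, D.Reachable z r → D.dist z r = n → τ z = b := by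
    intro n
    induction n with
    | zero => intro z hz h0; rw [hz.dist_eq_zero_iff.1 h0, hr]
    | succ n ih =>
      intro z hz hn
      obtain ⟨p, hp⟩ := hz.exists_walk_length_eq_dist
      cases p with
      | nil => exact hr
      | @cons _ z' _ hzz' q =>
        have hq : D.dist z' r ≤ n := by
          have := D.dist_le q
          simp only [Walk.length_cons] at hp
          omega
        have hn' : D.dist z r ≤ D.dist z' r + 1 := by
          obtain ⟨q', hq'⟩ := q.reachable.exists_walk_length_eq_dist
          have := D.dist_le (Walk.cons hzz' q')
          simpa [hq'] using this
        have hz' := ih z' q.reachable (by omega)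
        have hadj := hzz'
        rw [hD, deleteEdges_adj] at hadj
        have hne : s(z', z) ≠ s(x, y) := by
          rw [Sym2.eq_swap]; simpa using hadj.2
        have hne' : s(z, z') ≠ s(x, y) := by simpa using hadj.2
        have := hno z' z hadj.1.symm
        simp only [hne, hne', if_false] at this
        rw [if_pos (by omega), if_neg (by omega)] at this
        simpa using this hz'
  have := hno x y hxy
  rw [key _ x hx rfl, key _ y hy rfl] at this
  simp [Sym2.eq_swap] at this

/-- Two edge-disjoint subgraphs that can each force the vertex `r`, to opposite values. -/
theorem Refutable.of_forcing {α : Type} {G K T : SimpleGraph α} (hK : K ≤ G) (hT : T ≤ G)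
    (hdisj : ∀ a b, T.Adj a b → ¬ K.Adj a b) (r : α)
    (hfK : ∃ f : α → α → Bool, ∀ τ : α → Bool, τ r = true →
      ∃ u v, K.Adj u v ∧ τ u = f u v ∧ τ v = f v u)
    (hfT : ∃ f : α → α → Bool, ∀ τ : α → Bool, τ r = false →
      ∃ u v, T.Adj u v ∧ τ u = f u v ∧ τ v = f v u) : Refutable G := by
  classical
  obtain ⟨f, hf⟩ := hfK
  obtain ⟨g, hg⟩ := hfT
  refine ⟨fun a b => if K.Adj a b then f a b else g a b, fun τ => ?_⟩
  cases hr : τ r with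
  | true =>
    obtain ⟨u, v, h, h1, h2⟩ := hf τ hr
    exact ⟨u, v, hK h, by simp [h, h1], by simp [h.symm, h2]⟩
  | false =>
    obtain ⟨u, v, h, h1, h2⟩ := hg τ hr
    exact ⟨u, v, hT h, by simp [hdisj u v h, h1], by simp [hdisj v u h.symm, h2]⟩

theorem Refutable.of_induce {α : Type} {G : SimpleGraph α} {s : Set α}
    (h : Refutable (G.induce s)) : Refutable G := by
  classical
  obtain ⟨f, hf⟩ := h
  refine ⟨fun a b => if h : a ∈ s ∧ b ∈ s then f ⟨a, h.1⟩ ⟨b, h.2⟩ else true, fun τ => ?_⟩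
  obtain ⟨⟨u, hu⟩, ⟨v, hv⟩, huv, h1, h2⟩ := hf fun a => τ a
  exact ⟨u, v, huv, by simpa [hu, hv] using h1, by simpa [hu, hv] using h2⟩

/-- Replacing the edge `uv` by a path `u - w - v` preserves refutability. -/
theorem Refutable.of_suppress {α : Type} {G : SimpleGraph α} {u v w : α}
    (hwu : G.Adj w u) (hwv : G.Adj w v) (huv : u ≠ v)
    (h : Refutable ((G ⊔ edge u v).induce {w}ᶜ)) : Refutable G := by
  classical
  obtain ⟨f, hf⟩ := h
  have hu : u ≠ w := hwu.ne'
  have hv : v ≠ w := hwv.ne'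
  let F : α → α → Bool := fun a b =>
    if a = w then decide (b = u)
    else if b = w then
      (if a = u then f ⟨u, hu⟩ ⟨v, hv⟩ else f ⟨v, hv⟩ ⟨u, hu⟩)
    else if h : a ≠ w ∧ b ≠ w then f ⟨a, h.1⟩ ⟨b, h.2⟩ else true
  refine ⟨F, fun τ => ?_⟩
  obtain ⟨⟨a, ha⟩, ⟨b, hb⟩, hab, h1, h2⟩ := hf fun a => τ a
  have ha' : a ≠ w := ha
  have hb' : b ≠ w := hb
  have main : τ u = f ⟨u, hu⟩ ⟨v, hv⟩ → τ v = f ⟨v, hv⟩ ⟨u, hu⟩ →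
      ∃ a b, G.Adj a b ∧ τ a = F a b ∧ τ b = F b a := fun e1 e2 => by
    cases hw : τ w with
    | true => exact ⟨u, w, hwu.symm, by simp [F, hu, e1], by simp [F, hw]⟩
    | false => exact ⟨v, w, hwv.symm, by simp [F, hv, e2, huv.symm], by simp [F, hw, huv.symm]⟩
  have hab' : G.Adj a b ∨ (edge u v).Adj a b := hab
  rcases hab' with hab' | hab'
  · exact ⟨a, b, hab', by simpa [F, ha', hb'] using h1, by simpa [F, ha', hb'] using h2⟩
  · rw [edge_adj] at hab'
    rcases hab'.1 with ⟨rfl, rfl⟩ | ⟨rfl, rfl⟩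
    · exact main h1 h2
    · exact main h2 h1

theorem refutable_of_card_eq_four {α : Type} [Fintype α] {G : SimpleGraph α}
    (hcard : Fintype.card α = 4) (hG : ∀ a b, a ≠ b → G.Adj a b) : Refutable G := by
  have h4 : ∃ f : Fin 4 → Fin 4 → Bool, ∀ τ : Fin 4 → Bool,
      ∃ u v, u ≠ v ∧ τ u = f u v ∧ τ v = f v u :=
    ⟨![![true, true, true, false], ![false, true, true, false],
      ![true, false, true, true], ![false, true, true, true]], by decide⟩
  obtain ⟨f, hf⟩ := h4
  let e := Fintype.equivFinOfCardEq hcard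
  refine ⟨fun a b => f (e a) (e b), fun τ => ?_⟩
  obtain ⟨u, v, huv, h1, h2⟩ := hf fun i => τ (e.symm i)
  exact ⟨e.symm u, e.symm v, hG _ _ (by simpa using huv), by simpa using h1, by simpa using h2⟩

theorem ncard_edgeSet_lt_of_isAcyclic {α : Type} [Fintype α] [Nonempty α] {G : SimpleGraph α}
    (h : G.IsAcyclic) : G.edgeSet.ncard < Fintype.card α := by
  classical
  obtain ⟨T, hGT, -, hT⟩ :=
    (connected_top (V := α)).exists_isTree_le_of_le_of_isAcyclic le_top h
  have h1 := hT.card_edgeFinset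
  have h2 := Set.ncard_le_ncard (edgeSet_mono hGT) (Set.toFinite _)
  rw [← coe_edgeFinset T, Set.ncard_coe_finset] at h2
  omega

/-- A connected graph with enough edges and a vertex `w` of degree two lying on a triangle. -/
theorem refutable_of_triangle {α : Type} [Fintype α] {G : SimpleGraph α} (hconn : G.Connected)
    (hcyc : Fintype.card α + 2 ≤ G.edgeSet.ncard) {u v w : α} (huv : G.Adj u v)
    (hwu : G.Adj w u) (hwv : G.Adj w v) (hw : ∀ z, G.Adj w z → z = u ∨ z = v) :
    Refutable G := by
  classical
  have := hconn.nonempty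
  let E : Set (Sym2 α) := {s(u, v), s(w, u), s(w, v)}
  let K := G.deleteEdges E
  let T := fromEdgeSet E
  have hKadj : ∀ a b, K.Adj a b ↔ G.Adj a b ∧ s(a, b) ∉ E := fun a b => deleteEdges_adj
  have hTadj : ∀ a b, T.Adj a b ↔ s(a, b) ∈ E ∧ a ≠ b := fun a b => fromEdgeSet_adj E
  have hKG : K ≤ G := fun a b h => ((hKadj a b).1 h).1
  have hTG : T ≤ G := by
    intro a b h
    have h1 := ((hTadj a b).1 h).1
    change s(a, b) ∈ G.edgeSet
    rcases h1 with h1 | h1 | h1 <;> rw [h1]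
    exacts [huv, hwu, hwv]
  have hKw : ∀ z, ¬ K.Adj w z := by
    intro z hz
    have hz' := (hKadj w z).1 hz
    rcases hw z hz'.1 with rfl | rfl
    · exact hz'.2 (by simp [E])
    · exact hz'.2 (by simp [E])
  have hreach : ∀ z, z ≠ w → K.Reachable z u ∨ K.Reachable z v := by
    intro z
    obtain ⟨p⟩ := hconn.preconnected z u
    suffices H : ∀ t, t = u → ∀ z (p : G.Walk z t), z ≠ w → K.Reachable z u ∨ K.Reachable z v from
      H u rfl z p
    intro t ht z p
    induction p with
    | nil => intro _; subst ht; exact Or.inl (Reachable.refl _)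
    | @cons a c t hac q ih =>
      intro haw
      by_cases hcw : c = w
      · subst hcw
        rcases hw a hac.symm with rfl | rfl
        · exact Or.inl (Reachable.refl _)
        · exact Or.inr (Reachable.refl _)
      · by_cases hE : s(a, c) = s(u, v)
        · rcases Sym2.eq_iff.1 hE with ⟨rfl, -⟩ | ⟨rfl, -⟩
          · exact Or.inl (Reachable.refl _)
          · exact Or.inr (Reachable.refl _)
        · have hK : K.Adj a c := by
            refine (hKadj a c).2 ⟨hac, ?_⟩
            simp only [E, Set.mem_insert_iff, Set.mem_singleton_iff, hE, false_or, Sym2.eq_iff]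
            tauto
          exact (ih ht hcw).imp hK.reachable.trans hK.reachable.trans
  have hcycle : ¬ K.IsAcyclic := by
    intro hac
    have hnr : ¬ K.Reachable w u := by
      rintro ⟨p⟩
      cases p with
      | nil => exact hwu.ne rfl
      | cons h _ => exact hKw _ h
    have h1 := ncard_edgeSet_lt_of_isAcyclic (hac.sup_edge_of_not_reachable hnr)
    have hsub : G.edgeSet ⊆ insert s(u, v) (insert s(w, v) (K ⊔ edge w u).edgeSet) := by
      intro e
      induction e with
      | h a b =>
        intro hab
        have hab' : G.Adj a b := hab
        by_cases hE : s(a, b) ∈ E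
        · rcases hE with h | h | h
          · exact Or.inl h
          · refine Or.inr (Or.inr ?_)
            rw [h]
            exact Or.inr (by rw [edge_adj]; exact ⟨Or.inl ⟨rfl, rfl⟩, hwu.ne⟩)
          · exact Or.inr (Or.inl h)
        · exact Or.inr (Or.inr (Or.inl ((hKadj a b).2 ⟨hab', hE⟩)))
    have h2 := Set.ncard_le_ncard hsub (Set.toFinite _)
    have h3 := Set.ncard_insert_le s(u, v) (insert s(w, v) (K ⊔ edge w u).edgeSet)
    have h4 := Set.ncard_insert_le s(w, v) (K ⊔ edge w u).edgeSet
    omega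
  rw [isAcyclic_iff_forall_adj_isBridge] at hcycle
  push Not at hcycle
  obtain ⟨x, y, hxy, hbr⟩ := hcycle
  rw [isBridge_iff, not_not] at hbr
  have hpres : ∀ a b, K.Reachable a b → (K.deleteEdges {s(x, y)}).Reachable a b := by
    rintro a b ⟨p⟩
    induction p with
    | nil => exact Reachable.refl _
    | @cons a c _ hac q ih =>
      refine Reachable.trans ?_ ih
      by_cases he : s(a, c) = s(x, y)
      · rcases Sym2.eq_iff.1 he with ⟨rfl, rfl⟩ | ⟨rfl, rfl⟩
        exacts [hbr, hbr.symm]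
      · exact Adj.reachable (deleteEdges_adj.2 ⟨hac, by simpa using he⟩)
  have hxw : x ≠ w := fun h => hKw y (h ▸ hxy)
  have hdisj : ∀ a b, T.Adj a b → ¬ K.Adj a b := fun a b h1 h2 =>
    ((hKadj a b).1 h2).2 ((hTadj a b).1 h1).1
  have hTuv : T.Adj u v := (hTadj _ _).2 ⟨by simp [E], huv.ne⟩
  have hTwu : T.Adj w u := (hTadj _ _).2 ⟨by simp [E], hwu.ne⟩
  have hTwv : T.Adj w v := (hTadj _ _).2 ⟨by simp [E], hwv.ne⟩
  rcases hreach x hxw with hr | hr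
  · refine Refutable.of_forcing hKG hTG hdisj u
      (exists_forcing K hxy (hpres _ _ hr) (hbr.symm.trans (hpres _ _ hr)) true)
      (exists_forcing T hTwv (Adj.reachable ?_) (Adj.reachable ?_) false)
    · simp [deleteEdges_adj, hTwu, huv.ne, hwv.ne]
    · simp [deleteEdges_adj, hTuv.symm, huv.ne, hwu.ne', hwv.ne']
  · refine Refutable.of_forcing hKG hTG hdisj v
      (exists_forcing K hxy (hpres _ _ hr) (hbr.symm.trans (hpres _ _ hr)) true)
      (exists_forcing T hTwu (Adj.reachable ?_) (Adj.reachable ?_) false)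
    · simp [deleteEdges_adj, hTwv, huv.ne', hwu.ne]
    · simp [deleteEdges_adj, hTuv, huv.ne', hwu.ne', hwv.ne']

/-- Deleting a leaf keeps a graph connected and removes only one edge. -/
theorem connected_induce_compl_leaf {α : Type} [Fintype α] {G : SimpleGraph α}
    (hconn : G.Connected) {w v : α} (hw : ∀ z, G.Adj w z ↔ z = v) :
    (G.induce {w}ᶜ).Connected ∧ G.edgeSet.ncard ≤ (G.induce {w}ᶜ).edgeSet.ncard + 1 := by
  classical
  constructor
  · refine hconn.induce_compl_singleton_of_degree_eq_one ?_
    rw [degree_eq_one_iff_existsUnique_adj]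
    exact ⟨v, (hw v).2 rfl, fun z hz => (hw z).1 hz⟩
  · have hsub : G.edgeSet ⊆ insert s(w, v)
        (Sym2.map Subtype.val '' (G.induce {w}ᶜ).edgeSet) := by
      intro e
      induction e with
      | h a b =>
        intro hab
        have hab' : G.Adj a b := hab
        by_cases ha : a = w
        · subst ha
          rw [(hw b).1 hab']
          exact Or.inl rfl
        by_cases hb : b = w
        · subst hb
          rw [(hw a).1 hab'.symm]
          exact Or.inl Sym2.eq_swap
        exact Or.inr ⟨s(⟨a, ha⟩, ⟨b, hb⟩), hab', rfl⟩
    have h1 := Set.ncard_le_ncard hsub (Set.toFinite _)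
    have h2 := Set.ncard_insert_le s(w, v) (Sym2.map Subtype.val '' (G.induce {w}ᶜ).edgeSet)
    have h3 := Set.ncard_image_le (f := Sym2.map Subtype.val)
      (Set.toFinite (G.induce {w}ᶜ).edgeSet)
    omega

/-- Suppressing a vertex of degree two with non-adjacent neighbours keeps a graph connected
and removes only one edge. -/
theorem connected_suppress {α : Type} [Fintype α] {G : SimpleGraph α}
    (hconn : G.Connected) {u v w : α} (hwu : G.Adj w u) (hwv : G.Adj w v) (huv : u ≠ v)
    (hnadj : ¬ G.Adj u v) (hw : ∀ z, G.Adj w z → z = u ∨ z = v) :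
    ((G ⊔ edge u v).induce {w}ᶜ).Connected ∧
      G.edgeSet.ncard ≤ ((G ⊔ edge u v).induce {w}ᶜ).edgeSet.ncard + 1 := by
  classical
  let L := (G ⊔ edge u v).deleteEdges {s(w, u)}
  have hLadj : ∀ a b, L.Adj a b ↔ (G ⊔ edge u v).Adj a b ∧ s(a, b) ≠ s(w, u) := fun a b =>
    deleteEdges_adj
  have hLuv : L.Adj v u := (hLadj _ _).2
    ⟨Or.inr (by simp [edge_adj, huv.symm]), by simp [hwv.ne', huv.symm]⟩
  have hLwv : L.Adj w v := (hLadj _ _).2 ⟨Or.inl hwv, by simp [huv.symm, hwu.ne]⟩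
  have hL : L.Connected := by
    refine (hconn.mono le_sup_left).connected_delete_edge_of_not_isBridge ?_
    rw [isBridge_iff, not_not]
    exact hLwv.reachable.trans hLuv.reachable
  have hLw : ∀ z, L.Adj w z ↔ z = v := by
    refine fun z => ⟨fun hz => ?_, fun hz => hz ▸ hLwv⟩
    obtain ⟨h1, h2⟩ := (hLadj _ _).1 hz
    rcases h1 with h1 | h1
    · rcases hw z h1 with rfl | rfl
      · exact absurd rfl h2
      · rfl
    · rw [edge_adj] at h1
      rcases h1.1 with ⟨h, -⟩ | ⟨h, -⟩
      · exact absurd h hwu.ne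
      · exact absurd h hwv.ne
  have hind : L.induce {w}ᶜ = (G ⊔ edge u v).induce {w}ᶜ := by
    ext ⟨a, ha⟩ ⟨b, hb⟩
    have ha' : a ≠ w := ha
    have hb' : b ≠ w := hb
    change L.Adj a b ↔ (G ⊔ edge u v).Adj a b
    rw [hLadj]
    simp [ha', hb']
  obtain ⟨h1, h2⟩ := connected_induce_compl_leaf hL hLw
  rw [hind] at h1 h2
  refine ⟨h1, le_trans ?_ h2⟩
  have hset : insert s(u, v) (G.edgeSet \ {s(w, u)}) ⊆ L.edgeSet := by
    rintro e (rfl | ⟨he, hne⟩)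
    · exact hLuv.symm
    · induction e with
      | h a b => exact (hLadj a b).2 ⟨Or.inl he, hne⟩
  have h3 := Set.ncard_le_ncard hset (Set.toFinite _)
  rw [Set.ncard_insert_of_notMem (fun h => hnadj h.1) (Set.toFinite _)] at h3
  have h4 := Set.ncard_sdiff_singleton_add_one (show s(w, u) ∈ G.edgeSet from hwu)
    (Set.toFinite _)
  omega

theorem card_compl_singleton_add_one {α : Type} [Fintype α] (w : α)
    [Fintype ({w}ᶜ : Set α)] : Fintype.card ({w}ᶜ : Set α) + 1 = Fintype.card α := by
  classical
  have h := Fintype.card_compl_set ({w} : Set α)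
  have hpos : 0 < Fintype.card α := Fintype.card_pos_iff.2 ⟨w⟩
  simp only [Fintype.card_unique] at h
  rw [← Nat.card_eq_fintype_card] at h ⊢
  omega

/-- With minimum degree three and two more edges than vertices, a graph is complete on four
vertices. -/
theorem eq_top_of_three_le_degree {α : Type} [Fintype α] [Nonempty α] {G : SimpleGraph α}
    [DecidableRel G.Adj] (hcard : G.edgeSet.ncard ≤ Fintype.card α + 2)
    (hdeg : ∀ w, 3 ≤ G.degree w) :
    Fintype.card α = 4 ∧ ∀ a b, a ≠ b → G.Adj a b := by
  classical
  have hsum := G.sum_degrees_eq_twice_card_edges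
  rw [← coe_edgeFinset G, Set.ncard_coe_finset] at hcard
  have h3 : Fintype.card α * 3 ≤ ∑ w, G.degree w := by
    rw [← smul_eq_mul]
    exact Finset.card_nsmul_le_sum _ _ _ fun w _ => hdeg w
  have hlt : ∀ w, G.degree w < Fintype.card α := fun w => G.degree_lt_card_verts w
  have h4 : Fintype.card α = 4 := by
    have := hdeg (Classical.arbitrary α)
    have := hlt (Classical.arbitrary α)
    omega
  refine ⟨h4, fun a b hab => ?_⟩
  have hsub : G.neighborFinset a ⊆ Finset.univ.erase a := fun z hz => by
    rw [mem_neighborFinset] at hz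
    simp [hz.ne']
  have heq : G.neighborFinset a = Finset.univ.erase a := by
    refine Finset.eq_of_subset_of_card_le hsub ?_
    rw [Finset.card_erase_of_mem (Finset.mem_univ _), Finset.card_univ, h4]
    exact hdeg a
  rw [← mem_neighborFinset, heq]
  simp [hab.symm]

theorem refutable_of_connected (m : ℕ) : ∀ (n : ℕ) {α : Type} [Fintype α] (G : SimpleGraph α),
    G.Connected → Fintype.card α = m → G.edgeSet.ncard = n → m + 2 ≤ n → Refutable G := by
  classical
  induction m using Nat.strong_induction_on with
  | _ m ihm =>
  intro n
  induction n using Nat.strong_induction_on with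
  | _ n ihn =>
  intro α _ G hconn hm hn hcyc
  have := hconn.nonempty
  by_cases hbig : m + 2 < n
  · have hac : ¬ G.IsAcyclic := fun h => by
      have := ncard_edgeSet_lt_of_isAcyclic h
      omega
    rw [isAcyclic_iff_forall_adj_isBridge] at hac
    push Not at hac
    obtain ⟨x, y, hxy, hbr⟩ := hac
    have hcard : (G.deleteEdges {s(x, y)}).edgeSet.ncard + 1 = n := by
      rw [edgeSet_deleteEdges, Set.ncard_sdiff_singleton_add_one (show s(x, y) ∈ G.edgeSet from hxy)
        (Set.toFinite _), hn]
    exact (ihn _ (by omega) _ (hconn.connected_delete_edge_of_not_isBridge hbr) hm rfl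
      (by omega)).mono (deleteEdges_le _)
  by_cases hdeg : ∀ w, 3 ≤ G.degree w
  · obtain ⟨h4, hadj⟩ := eq_top_of_three_le_degree (by omega) hdeg
    exact refutable_of_card_eq_four h4 hadj
  push Not at hdeg
  obtain ⟨w, hdw⟩ := hdeg
  have hcw := card_compl_singleton_add_one w
  have hshrink : ∀ H : SimpleGraph α, (H.induce {w}ᶜ).Connected ∧
      G.edgeSet.ncard ≤ (H.induce {w}ᶜ).edgeSet.ncard + 1 → Refutable (H.induce {w}ᶜ) :=
    fun H h => ihm _ (by omega) _ _ h.1 rfl rfl (by omega)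
  have hpos : 0 < G.degree w := by
    have : Nontrivial α := by
      by_contra h
      rw [not_nontrivial_iff_subsingleton] at h
      have := ncard_edgeSet_lt_of_isAcyclic (IsAcyclic.of_subsingleton (G := G))
      omega
    exact hconn.preconnected.degree_pos_of_nontrivial w
  by_cases h1 : G.degree w = 1
  · obtain ⟨v, hv, huniq⟩ := degree_eq_one_iff_existsUnique_adj.1 h1
    exact (hshrink G (connected_induce_compl_leaf hconn
      fun z => ⟨huniq z, fun h => h ▸ hv⟩)).of_induce
  · have h2 : (G.neighborFinset w).card = 2 := by
      rw [card_neighborFinset_eq_degree]; omega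
    obtain ⟨u, v, huv, hN⟩ := Finset.card_eq_two.1 h2
    have hw : ∀ z, G.Adj w z ↔ z = u ∨ z = v := fun z => by
      rw [← mem_neighborFinset, hN]; simp
    have hwu := (hw u).2 (Or.inl rfl)
    have hwv := (hw v).2 (Or.inr rfl)
    by_cases hadj : G.Adj u v
    · exact refutable_of_triangle hconn (by omega) hadj hwu hwv fun z => (hw z).1
    · exact (hshrink _ (connected_suppress hconn hwu hwv huv hadj
        fun z => (hw z).1)).of_suppress hwu hwv huv

/-- Every finite connected simple graph with at least three independent cycles
(`|E(G)| ≥ |V(G)| + 2`) is in `𝒰`. -/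
theorem stmt_18 {α : Type} [Fintype α] (G : SimpleGraph α)
    (hconn : G.Connected)
    (hcyc : Fintype.card α + 2 ≤ G.edgeSet.ncard) :
    InU G := by
  exact (refutable_of_connected _ _ G hconn rfl rfl hcyc).inU

end Sat2
end
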